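/- Fix τ with 0 < τ < 2 and τ ≠ 1. Then as N → ∞ over positive integers, (τ/2)·( 1 + (1/2)·( ψ(N + 1/2) − ψ(N·|1 − τ| + 1/2) ) ) = τ/2 − (τ/4)·log|1 − τ| + (τ/(96N²))·(1 − 1/(1 − τ)²) + O(N⁻⁴); that is, there exist C > 0 and N₀ such that for all N ≥ N₀ the difference between the left-hand side and τ/2 − (τ/4)·log|1−τ| + (τ/(96N²))·(1 − 1/(1−τ)²) is at most C·N⁻⁴ in absolute value. -/

import Mathlib

open Real

/-- The digamma function `ψ(x) = Γ'(x)/Γ(x)` on the reals. -/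
noncomputable def digamma (x : ℝ) : ℝ := deriv Real.Gamma x / Real.Gamma x

lemma aux_diff {y : ℝ} (hy : 0 < y) : DifferentiableAt ℝ Real.Gamma y := by
  refine Real.differentiableAt_Gamma fun m => ?_
  have : (0 : ℝ) ≤ m := Nat.cast_nonneg m
  intro h
  linarith

lemma aux_hasDeriv {y : ℝ} (hy : 0 < y) :
    HasDerivAt (Real.log ∘ Real.Gamma) (digamma y) y :=
  (aux_diff hy).hasDerivAt.log (Real.Gamma_pos_of_pos hy).ne'

lemma aux_logGamma {y : ℝ} (hy : 0 < y) :
    Real.log (Real.Gamma (y + 1)) = Real.log y + Real.log (Real.Gamma y) := by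
  rw [Real.Gamma_add_one hy.ne', Real.log_mul hy.ne' (Real.Gamma_pos_of_pos hy).ne']

lemma aux_rec {y : ℝ} (hy : 0 < y) : digamma (y + 1) = digamma y + 1 / y := by
  have h1 : HasDerivAt (fun t => (Real.log ∘ Real.Gamma) (t + 1)) (digamma (y + 1)) y :=
    (aux_hasDeriv (by linarith : 0 < y + 1)).comp_add_const y 1
  have h2 : HasDerivAt (fun t => Real.log t + (Real.log ∘ Real.Gamma) t) (y⁻¹ + digamma y) y :=
    (Real.hasDerivAt_log hy.ne').add (aux_hasDeriv hy)
  have h3 : HasDerivAt (fun t => (Real.log ∘ Real.Gamma) (t + 1)) (y⁻¹ + digamma y) y := by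
    refine h2.congr_of_eventuallyEq ?_
    filter_upwards [lt_mem_nhds hy] with t ht
    exact aux_logGamma ht
  rw [h1.unique h3, one_div]
  ring

lemma aux_upper {y : ℝ} (hy : 0 < y) : digamma y ≤ Real.log y := by
  have h := Real.convexOn_log_Gamma.le_slope_of_hasDerivAt (x := y) (y := y + 1)
    (Set.mem_Ioi.2 hy) (Set.mem_Ioi.2 (by linarith)) (by linarith) (aux_hasDeriv hy)
  rw [slope_def_field, Function.comp, Function.comp, aux_logGamma hy] at h
  simpa using h

lemma aux_lower {y : ℝ} (hy : 0 < y) : Real.log y ≤ digamma (y + 1) := by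
  have h := Real.convexOn_log_Gamma.slope_le_of_hasDerivAt (x := y) (y := y + 1)
    (Set.mem_Ioi.2 hy) (Set.mem_Ioi.2 (by linarith)) (by linarith)
    (aux_hasDeriv (by linarith : 0 < y + 1))
  rw [slope_def_field, Function.comp, Function.comp, aux_logGamma hy] at h
  simpa using h

/-- The remainder in the expansion of the digamma function. -/
noncomputable def auxG (x : ℝ) : ℝ := digamma (x + 1 / 2) - Real.log x - 1 / (24 * x ^ 2)

lemma aux_crude {x : ℝ} (hx : 1 ≤ x) : |auxG x| ≤ 2 / x := by
  have h0 : 0 < x := by linarith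
  have h1 := aux_upper (by linarith : 0 < x + 1 / 2)
  have h2 := aux_lower (by linarith : 0 < x - 1 / 2)
  rw [show x - 1 / 2 + 1 = x + 1 / 2 by ring] at h2
  have h3 := Real.log_le_sub_one_of_pos (show 0 < (x + 1 / 2) / x by positivity)
  rw [Real.log_div (by linarith) h0.ne'] at h3
  have h4 := Real.log_le_sub_one_of_pos (show 0 < x / (x - 1 / 2) from
    div_pos h0 (by linarith))
  rw [Real.log_div h0.ne' (by linarith)] at h4
  have h5 : (x + 1 / 2) / x - 1 ≤ 1 / x := by
    rw [div_sub_one h0.ne']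
    gcongr
    linarith
  have h6 : x / (x - 1 / 2) - 1 ≤ 1 / x := by
    have h7 : 0 < x - 1 / 2 := by linarith
    rw [div_sub_one h7.ne', div_le_div_iff₀ h7 h0]
    linarith
  have h8 : 1 / (24 * x ^ 2) ≤ 1 / x := by
    apply one_div_le_one_div_of_le h0
    nlinarith
  have h9 : 0 ≤ 1 / (24 * x ^ 2) := by positivity
  have h10 : 2 / x = 1 / x + 1 / x := by ring
  unfold auxG
  rw [abs_le]
  constructor <;> linarith

lemma aux_u {u : ℝ} (h0 : 0 < u) (h1 : u < 1) :
    |2 * u - Real.log ((1 + u) / (1 - u)) + 2 / 3 * u ^ 3 / (1 - u ^ 2) ^ 2|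
      ≤ 128 * u ^ 5 * (1 + u ^ 2) / (1 - u ^ 2) ^ 4 := by
  have hl := Real.sum_range_le_log_div h0.le h1 2
  have hu := Real.log_div_le_sum_range_add h0.le h1 2
  norm_num [Finset.sum_range_succ] at hl hu
  have hv0 : 0 < u ^ 2 := by positivity
  have hv : 0 < 1 - u ^ 2 := by nlinarith
  have e1 : 2 / 3 * u ^ 3 / (1 - u ^ 2) ^ 2 =
      2 / 3 * u ^ 3 + u ^ 5 * (2 / 3 * (2 - u ^ 2) / (1 - u ^ 2) ^ 2) := by
    field_simp
    ring
  have k1 : 2 / 3 * (2 - u ^ 2) / (1 - u ^ 2) ^ 2 ≤ 128 * (1 + u ^ 2) / (1 - u ^ 2) ^ 4 := by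
    apply div_le_div₀ (by positivity) (by linarith) (by positivity)
    exact pow_le_pow_of_le_one hv.le (by linarith) (by norm_num)
  have k2 : 2 / (1 - u ^ 2) ≤ 128 * (1 + u ^ 2) / (1 - u ^ 2) ^ 4 := by
    apply div_le_div₀ (by positivity) (by linarith) (by positivity)
    exact pow_le_of_le_one hv.le (by linarith) (by norm_num)
  have k3 : 0 ≤ 2 / 3 * (2 - u ^ 2) / (1 - u ^ 2) ^ 2 :=
    div_nonneg (by linarith) (by positivity)
  have h5 : 0 < u ^ 5 := by positivity
  have k1' := mul_le_mul_of_nonneg_left k1 h5.le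
  have k2' := mul_le_mul_of_nonneg_left k2 h5.le
  have k3' := mul_nonneg h5.le k3
  have e2 : 128 * u ^ 5 * (1 + u ^ 2) / (1 - u ^ 2) ^ 4 =
      u ^ 5 * (128 * (1 + u ^ 2) / (1 - u ^ 2) ^ 4) := by ring
  have e3 : u ^ 5 * (2 / (1 - u ^ 2)) = 2 * (u ^ 5 / (1 - u ^ 2)) := by ring
  rw [e1, e2, abs_le]
  constructor <;> linarith

lemma aux_step {x : ℝ} (hx : 0 < x) :
    |auxG (x + 1) - auxG x| ≤ 1 / x ^ 4 - 1 / (x + 1) ^ 4 := by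
  have hp : 0 < 2 * x + 1 := by linarith
  have h := aux_u (u := 1 / (2 * x + 1)) (by positivity) (by rw [div_lt_one hp]; linarith)
  have hq : 1 - (1 / (2 * x + 1)) ^ 2 = 4 * x * (x + 1) / (2 * x + 1) ^ 2 := by
    field_simp
    ring
  have hL : (1 + 1 / (2 * x + 1)) / (1 - 1 / (2 * x + 1)) = (x + 1) / x := by
    have : 1 - 1 / (2 * x + 1) = 2 * x / (2 * x + 1) := by field_simp; ring
    rw [this]
    field_simp
    ring
  rw [hq, hL, Real.log_div (by linarith) hx.ne'] at h
  have hr := aux_rec (by linarith : 0 < x + 1 / 2)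
  convert h using 1
  · congr 1
    unfold auxG
    rw [show x + 1 + 1 / 2 = x + 1 / 2 + 1 by ring, hr]
    have a1 : 1 / (x + 1 / 2) = 2 * (1 / (2 * x + 1)) := by field_simp
    have a2 : 1 / (24 * x ^ 2) - 1 / (24 * (x + 1) ^ 2) =
        2 / 3 * (1 / (2 * x + 1)) ^ 3 / (4 * x * (x + 1) / (2 * x + 1) ^ 2) ^ 2 := by
      field_simp
      ring
    rw [a1, ← a2]
    ring
  · field_simp
    ring

lemma aux_iter {x : ℝ} (hx : 0 < x) (n : ℕ) :
    |auxG x| ≤ |auxG (x + n)| + (1 / x ^ 4 - 1 / (x + n) ^ 4) := by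
  induction n with
  | zero => simp
  | succ n ih =>
    have hs := aux_step (by positivity : 0 < x + n)
    have ht := abs_sub_abs_le_abs_sub (auxG (x + n)) (auxG (x + n + 1))
    rw [abs_sub_comm] at ht
    push_cast
    rw [← add_assoc]
    linarith

lemma aux_bound {x : ℝ} (hx : 0 < x) : |auxG x| ≤ 1 / x ^ 4 := by
  have hlim : Filter.Tendsto (fun n : ℕ => 2 / (n : ℝ) + 1 / x ^ 4) Filter.atTop
      (nhds (0 + 1 / x ^ 4)) :=
    (tendsto_const_div_atTop_nhds_zero_nat 2).add_const _
  rw [zero_add] at hlim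
  refine ge_of_tendsto hlim ?_
  filter_upwards [Filter.eventually_ge_atTop 1] with n hn
  have hn' : (1 : ℝ) ≤ n := by exact_mod_cast hn
  have h1 := aux_iter hx n
  have h2 := aux_crude (by linarith : 1 ≤ x + n)
  have h3 : 2 / (x + n) ≤ 2 / (n : ℝ) := by
    gcongr
    linarith
  have h4 : 0 ≤ 1 / (x + n) ^ 4 := by positivity
  linarith

/-- Large-`N` expansion to order `N⁻²`, with error `O(N⁻⁴)`, of the bulk-scaled structure
function of the circular β-ensemble with β = 4 in the regime `0 < τ < 2`, `τ ≠ 1`. -/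
theorem cse_structure_function_expansion (τ : ℝ) (hτ0 : 0 < τ) (hτ2 : τ < 2) (hτ1 : τ ≠ 1) :
    ∃ C > (0 : ℝ), ∃ N₀ : ℕ, ∀ N : ℕ, N₀ ≤ N →
      |(τ / 2) * (1 + (1 / 2) * (digamma (N + 1 / 2) - digamma (N * |1 - τ| + 1 / 2)))
          - (τ / 2 - (τ / 4) * Real.log |1 - τ| +
              (τ / (96 * N ^ 2)) * (1 - 1 / (1 - τ) ^ 2))|
        ≤ C / N ^ 4 := by
  have ha : 0 < |1 - τ| := abs_pos.2 (sub_ne_zero.2 hτ1.symm)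
  have hsq : (1 - τ) ^ 2 = |1 - τ| ^ 2 := (sq_abs _).symm
  rw [hsq]
  generalize |1 - τ| = a at ha
  refine ⟨τ / 4 * (1 + 1 / a ^ 4), by positivity, 1, fun N hN => ?_⟩
  have hN' : (0 : ℝ) < N := by exact_mod_cast hN
  generalize (N : ℝ) = M at hN'
  have b1 := aux_bound hN'
  have b2 := aux_bound (mul_pos hN' ha)
  have key : (τ / 2) * (1 + (1 / 2) * (digamma (M + 1 / 2) - digamma (M * a + 1 / 2)))
          - (τ / 2 - (τ / 4) * Real.log a + (τ / (96 * M ^ 2)) * (1 - 1 / a ^ 2))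
      = τ / 4 * (auxG M - auxG (M * a)) := by
    unfold auxG
    rw [Real.log_mul hN'.ne' ha.ne']
    field_simp
    ring
  rw [key, abs_mul, abs_of_pos (by positivity : 0 < τ / 4), mul_div_assoc]
  gcongr
  have e : (1 + 1 / a ^ 4) / M ^ 4 = 1 / M ^ 4 + 1 / (M * a) ^ 4 := by
    field_simp
  rw [e]
  exact (abs_sub _ _).trans (add_le_add b1 b2)
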